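/- Combining the previous two facts: for an n-DoF pendulum with configuration space 𝕋ⁿ, smooth positive definite inertia tensor, smooth potential U, and energy E > max U, for every nonzero tuple (α₁, …, αₙ) ∈ ℤⁿ there exists a closed geodesic of the Jacobi metric on 𝕋ⁿ in the free homotopy class (α₁, …, αₙ); equivalently, there exists a periodic trajectory of the system at energy E performing αᵢ full rotations around joint i. -/

import Mathlib

open Matrix

/-- Partial derivative of a scalar field on `ℝⁿ` in the `i`-th coordinate direction. -/
noncomputable def partialDeriv' (n : ℕ) (f : (Fin n → ℝ) → ℝ) (i : Fin n)
    (x : Fin n → ℝ) : ℝ :=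
  deriv (fun h : ℝ => f (x + h • (Pi.single i 1 : Fin n → ℝ))) 0

/-- Christoffel symbols of the second kind of a metric `g` in coordinates. -/
noncomputable def christoffel (n : ℕ) (g : (Fin n → ℝ) → Matrix (Fin n) (Fin n) ℝ)
    (a b c : Fin n) (x : Fin n → ℝ) : ℝ :=
  (1/2) * ∑ i, (g x)⁻¹ a i *
    (partialDeriv' n (fun y => g y i b) c x + partialDeriv' n (fun y => g y i c) b x
      - partialDeriv' n (fun y => g y b c) i x)

/-- The geodesic equation `γ''ᵃ + Γᵃ_{bc} γ'ᵇ γ'ᶜ = 0`. -/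
def IsGeodesic (n : ℕ) (g : (Fin n → ℝ) → Matrix (Fin n) (Fin n) ℝ)
    (γ : ℝ → (Fin n → ℝ)) : Prop :=
  ∀ (a : Fin n) (s : ℝ),
    deriv (fun u => deriv (fun w => γ w a) u) s
      + ∑ b, ∑ c, christoffel n g a b c (γ s)
          * deriv (fun w => γ w b) s * deriv (fun w => γ w c) s = 0

/-- A lifted loop on the torus `𝕋ⁿ = ℝⁿ/ℤⁿ` of winding class `v ∈ ℤⁿ`. -/
def IsLiftedLoopOfClass (n : ℕ) (γ : ℝ → (Fin n → ℝ)) (v : Fin n → ℤ) : Prop :=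
  ∀ s, γ (s + 1) = γ s + fun i => (v i : ℝ)

section Discretization

open Filter Topology

variable {W : Type*} [NormedAddCommGroup W]

lemma norm_sub_le_of_forall_step {w : ℤ → W} {C : ℝ} {a b : ℤ}
    (h : ∀ j, min a b ≤ j → j < max a b → ‖w (j + 1) - w j‖ ≤ C) :
    ‖w b - w a‖ ≤ C * |(b : ℝ) - a| := by
  have key : ∀ a b : ℤ, a ≤ b → (∀ j, a ≤ j → j < b → ‖w (j + 1) - w j‖ ≤ C) →
      ‖w b - w a‖ ≤ C * ((b : ℝ) - a) := by
    intro a b hab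
    induction b, hab using Int.leInduction with
    | base => intro _; simp
    | succ b hab ih =>
      intro hstep
      have h1 := ih fun j hj hjb => hstep j hj (by omega)
      have h2 := hstep b hab (by omega)
      have h3 := norm_add_le (w (b + 1) - w b) (w b - w a)
      rw [sub_add_sub_cancel] at h3
      push_cast
      linarith
  rcases le_total a b with hab | hab
  · have hab' : (a : ℝ) ≤ b := by exact_mod_cast hab
    rw [abs_of_nonneg (sub_nonneg.2 hab')]
    exact key a b hab (by simpa [min_eq_left hab, max_eq_right hab] using h)
  · have hab' : (b : ℝ) ≤ a := by exact_mod_cast hab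
    rw [abs_sub_comm, abs_of_nonneg (sub_nonneg.2 hab'), norm_sub_rev]
    exact key b a hab (by simpa [min_eq_right hab, max_eq_left hab] using h)

lemma abs_floor_sub_floor_le (x y : ℝ) : |(⌊x⌋ : ℝ) - ⌊y⌋| ≤ |x - y| + 1 := by
  have h1 := Int.floor_le x
  have h2 := Int.lt_floor_add_one x
  have h3 := Int.floor_le y
  have h4 := Int.lt_floor_add_one y
  rcases abs_cases (x - y) with h | h <;> rw [abs_le] <;> constructor <;> linarith

lemma tendsto_intFloor_mul_div_nat (t : ℝ) :
    Tendsto (fun N : ℕ => (⌊(N : ℝ) * t⌋ : ℝ) / N) atTop (𝓝 t) := by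
  rw [tendsto_iff_norm_sub_tendsto_zero]
  refine squeeze_zero' (Eventually.of_forall fun _ => norm_nonneg _) ?_
    tendsto_one_div_atTop_nhds_zero_nat
  filter_upwards [eventually_gt_atTop 0] with N hN
  have hN' : (0 : ℝ) < N := by exact_mod_cast hN
  rw [Real.norm_eq_abs, div_sub' hN'.ne', abs_div, abs_of_pos hN']
  gcongr
  have h1 := Int.floor_le ((N : ℝ) * t)
  have h2 := Int.lt_floor_add_one ((N : ℝ) * t)
  rw [abs_le]
  constructor <;> linarith

/-- If step functions built from discrete solutions of `u' = F z`, with uniformly Lipschitz `z`,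
converge pointwise as the mesh tends to zero, then the limits solve `u' = F z`. -/
lemma hasDerivAt_of_tendsto_discrete {E : Type*} [NormedAddCommGroup E] [NormedSpace ℝ W]
    {l : Filter ℕ} [l.NeBot] (hl : l ≤ atTop) {z : ℕ → ℤ → E} {zlim : ℝ → E}
    {u : ℕ → ℤ → W} {ulim : ℝ → W} {F : E → W} (hF : Continuous F) {L : ℝ} {c : ℤ}
    (hz : ∀ t, Tendsto (fun N : ℕ => z N ⌊(N : ℝ) * t⌋) l (𝓝 (zlim t)))
    (hu : ∀ t, Tendsto (fun N : ℕ => u N ⌊(N : ℝ) * t⌋) l (𝓝 (ulim t)))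
    (hL : ∀ᶠ N : ℕ in l, ∀ j, ‖z N (j + 1) - z N j‖ ≤ L / N)
    (hstep : ∀ᶠ N : ℕ in l, ∀ j, u N (j + 1) - u N j = (N : ℝ)⁻¹ • F (z N (j + c)))
    (s : ℝ) : HasDerivAt ulim (F (zlim s)) s := by
  have hpos : ∀ᶠ N : ℕ in l, (0 : ℝ) < N := by
    filter_upwards [hl (eventually_gt_atTop 0)] with N hN
    exact_mod_cast hN
  have hL0 : 0 ≤ L := by
    obtain ⟨N, hN, hN'⟩ := (hL.and hpos).exists
    have := (norm_nonneg _).trans (hN 0)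
    by_contra! hneg
    exact absurd this (not_le.2 (div_neg_of_neg_of_pos hneg hN'))
  rw [hasDerivAt_iff_isLittleO, Asymptotics.isLittleO_iff]
  intro ε hε
  obtain ⟨δ, hδ, hFδ⟩ := Metric.continuousAt_iff.1 (hF.continuousAt (x := zlim s)) ε hε
  have hr : 0 < δ / (4 * (L + 1)) := by positivity
  filter_upwards [Metric.ball_mem_nhds s hr] with t ht
  rw [Metric.mem_ball, Real.dist_eq] at ht
  have hts : L * |t - s| ≤ δ / 4 := by
    rw [lt_div_iff₀ (by positivity)] at ht
    nlinarith [abs_nonneg (t - s)]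
  have hsmall : ∀ᶠ N : ℕ in l, L * (1 + |(c : ℝ)|) / N < δ / 4 := by
    have : Tendsto (fun N : ℕ => L * (1 + |(c : ℝ)|) / N) l (𝓝 0) :=
      (tendsto_const_div_atTop_nhds_zero_nat _).mono_left hl
    exact this.eventually (gt_mem_nhds (by positivity))
  have hnear : ∀ᶠ N : ℕ in l, ‖z N ⌊(N : ℝ) * s⌋ - zlim s‖ < δ / 4 := by
    filter_upwards [(hz s).eventually (Metric.ball_mem_nhds _ (by positivity : 0 < δ / 4))]
      with N hN
    rwa [← dist_eq_norm]
  have hdiscrete : ∀ᶠ N : ℕ in l,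
      ‖u N ⌊(N : ℝ) * t⌋ - u N ⌊(N : ℝ) * s⌋ -
        ((⌊(N : ℝ) * t⌋ : ℝ) / N - (⌊(N : ℝ) * s⌋ : ℝ) / N) • F (zlim s)‖ ≤
      ε * |(⌊(N : ℝ) * t⌋ : ℝ) / N - (⌊(N : ℝ) * s⌋ : ℝ) / N| := by
    filter_upwards [hpos, hL, hstep, hsmall, hnear] with N hN hLN hstepN hsmallN hnearN
    set a := ⌊(N : ℝ) * s⌋ with ha
    set b := ⌊(N : ℝ) * t⌋ with hb
    have hba : |(b : ℝ) - a| ≤ N * |t - s| + 1 := by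
      have := abs_floor_sub_floor_le ((N : ℝ) * t) (N * s)
      rwa [← mul_sub, abs_mul, abs_of_pos hN] at this
    have hmain := norm_sub_le_of_forall_step
      (w := fun j => u N j - ((j : ℝ) / N) • F (zlim s)) (C := ε / N) (a := a) (b := b) ?_
    · convert hmain using 1
      · congr 1
        rw [sub_smul]
        abel
      · rw [← sub_div, abs_div, abs_of_pos hN]
        ring
    intro j hj1 hj2
    have hja : |((j + c : ℤ) : ℝ) - a| ≤ N * |t - s| + 1 + |(c : ℝ)| := by
      have h1 : |(j : ℝ) - a| ≤ |(b : ℝ) - a| := by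
        have : |j - a| ≤ |b - a| := by
          rcases le_total a b with h | h
          · rw [abs_of_nonneg, abs_of_nonneg] <;> omega
          · rw [abs_of_nonpos, abs_of_nonpos] <;> omega
        exact_mod_cast this
      have h2 := abs_add_le ((j : ℝ) - a) c
      push_cast
      rw [add_sub_right_comm]
      linarith
    have hzj : dist (z N (j + c)) (zlim s) < δ := by
      rw [dist_eq_norm]
      have h1 := norm_sub_le_of_forall_step (w := z N) (a := a) (b := j + c)
        (fun k _ _ => hLN k)
      have h2 : L / N * |((j + c : ℤ) : ℝ) - a| ≤ δ / 4 + δ / 4 := by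
        calc L / N * |((j + c : ℤ) : ℝ) - a| ≤ L / N * (N * |t - s| + 1 + |(c : ℝ)|) := by
              gcongr
          _ = L * |t - s| + L * (1 + |(c : ℝ)|) / N := by field_simp; ring
          _ ≤ _ := by linarith
      have h3 := norm_add_le (z N (j + c) - z N a) (z N a - zlim s)
      rw [sub_add_sub_cancel] at h3
      linarith
    have hFj := hFδ hzj
    rw [dist_eq_norm] at hFj
    have : u N (j + 1) - (((j + 1 : ℤ) : ℝ) / N) • F (zlim s) -
        (u N j - ((j : ℝ) / N) • F (zlim s)) =
        (N : ℝ)⁻¹ • (F (z N (j + c)) - F (zlim s)) := by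
      rw [smul_sub, ← hstepN j]
      push_cast
      rw [add_div, add_smul, one_div]
      abel
    rw [this, norm_smul, norm_inv, Real.norm_of_nonneg hN.le, div_eq_inv_mul]
    gcongr
  have hfl : ∀ t : ℝ, Tendsto (fun N : ℕ => (⌊(N : ℝ) * t⌋ : ℝ) / N) l (𝓝 t) := fun t =>
    (tendsto_intFloor_mul_div_nat t).mono_left hl
  exact le_of_tendsto_of_tendsto
    ((((hu t).sub (hu s)).sub (((hfl t).sub (hfl s)).smul_const _)).norm)
    ((((hfl t).sub (hfl s)).abs).const_mul ε) hdiscrete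

/-- Solutions of an autonomous ordinary differential equation with smooth right-hand side are
smooth. -/
lemma contDiff_of_hasDerivAt_comp [NormedSpace ℝ W] {F : W → W}
    (hF : ContDiff ℝ (⊤ : ℕ∞) F) {z : ℝ → W} (hz : ∀ s, HasDerivAt z (F (z s)) s) :
    ContDiff ℝ (⊤ : ℕ∞) z := by
  rw [contDiff_infty]
  intro k
  have hderiv : deriv z = F ∘ z := funext fun s => (hz s).deriv
  induction k with
  | zero =>
    exact contDiff_zero.2 (continuous_iff_continuousAt.2 fun s => (hz s).continuousAt)
  | succ k ih =>
    push_cast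
    rw [contDiff_succ_iff_deriv, hderiv]
    refine ⟨fun s => (hz s).differentiableAt, by simp, ?_⟩
    exact (hF.of_le (by exact_mod_cast le_top)).comp ih

end Discretization

/-- A smooth Riemannian metric on `ℝⁿ` descending to the torus `ℝⁿ/ℤⁿ`. -/
structure IsPeriodicMetric (n : ℕ) (g : (Fin n → ℝ) → Matrix (Fin n) (Fin n) ℝ) : Prop where
  smooth : ∀ i j, ContDiff ℝ (⊤ : ℕ∞) (fun x => g x i j)
  symm : ∀ x, (g x).IsSymm
  posDef : ∀ x, (g x).PosDef
  periodic : ∀ (x : Fin n → ℝ) (k : Fin n → ℤ), g (x + fun i => (k i : ℝ)) = g x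

/-- The matrix of partial derivatives in the direction `i` of the entries of `g`. -/
noncomputable def metricDeriv (n : ℕ) (g : (Fin n → ℝ) → Matrix (Fin n) (Fin n) ℝ) (i : Fin n)
    (x : Fin n → ℝ) : Matrix (Fin n) (Fin n) ℝ :=
  fun b c => partialDeriv' n (fun y => g y b c) i x

/-- The velocity corresponding to the position `z.1` and the momentum `z.2`. -/
noncomputable def geodesicVelocity (n : ℕ) (g : (Fin n → ℝ) → Matrix (Fin n) (Fin n) ℝ)
    (z : (Fin n → ℝ) × (Fin n → ℝ)) : Fin n → ℝ :=
  (g z.1)⁻¹ *ᵥ z.2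

/-- The time derivative of the momentum along a geodesic with position `x` and velocity `w`. -/
noncomputable def metricForce (n : ℕ) (g : (Fin n → ℝ) → Matrix (Fin n) (Fin n) ℝ)
    (x w : Fin n → ℝ) : Fin n → ℝ :=
  fun i => (1 / 2) * (w ⬝ᵥ (metricDeriv n g i x *ᵥ w))

section PartialDerivatives

variable {n : ℕ} {f : (Fin n → ℝ) → ℝ}

lemma hasDerivAt_comp_add_smul_single (hf : Differentiable ℝ f) (i : Fin n) (x : Fin n → ℝ) :
    HasDerivAt (fun h : ℝ => f (x + h • (Pi.single i 1 : Fin n → ℝ)))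
      (fderiv ℝ f x (Pi.single i 1)) 0 := by
  have h1 : HasDerivAt (fun h : ℝ => x + h • (Pi.single i 1 : Fin n → ℝ)) (Pi.single i 1) 0 := by
    simpa using ((hasDerivAt_id (0 : ℝ)).smul_const (Pi.single i 1 : Fin n → ℝ)).const_add x
  have h2 : HasFDerivAt f (fderiv ℝ f x) (x + (0 : ℝ) • (Pi.single i 1 : Fin n → ℝ)) := by
    simpa using (hf x).hasFDerivAt
  exact h2.comp_hasDerivAt (0 : ℝ) h1

lemma partialDeriv'_eq_fderiv (hf : Differentiable ℝ f) (i : Fin n) (x : Fin n → ℝ) :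
    partialDeriv' n f i x = fderiv ℝ f x (Pi.single i 1) :=
  (hasDerivAt_comp_add_smul_single hf i x).deriv

lemma contDiff_partialDeriv' (hf : ContDiff ℝ (⊤ : ℕ∞) f) (i : Fin n) :
    ContDiff ℝ (⊤ : ℕ∞) (partialDeriv' n f i) := by
  have : partialDeriv' n f i = fun x => fderiv ℝ f x (Pi.single i 1) :=
    funext fun x => partialDeriv'_eq_fderiv (hf.differentiable (by simp)) i x
  rw [this]
  exact (hf.fderiv_right (m := (⊤ : ℕ∞)) (by simp)).clm_apply contDiff_const

lemma fderiv_apply_eq_sum_partialDeriv' (hf : Differentiable ℝ f) (x v : Fin n → ℝ) :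
    fderiv ℝ f x v = ∑ i, partialDeriv' n f i x * v i := by
  conv_lhs => rw [pi_eq_sum_univ' v]
  rw [map_sum]
  refine Finset.sum_congr rfl fun i _ => ?_
  rw [partialDeriv'_eq_fderiv hf, map_smul, smul_eq_mul, mul_comm]

end PartialDerivatives

section MatrixBounds

variable {n : ℕ}

lemma abs_dotProduct_le_card_mul (u w : Fin n → ℝ) : |u ⬝ᵥ w| ≤ n * (‖u‖ * ‖w‖) := by
  calc |u ⬝ᵥ w| ≤ ∑ i, |u i * w i| := Finset.abs_sum_le_sum_abs _ _
    _ ≤ ∑ _i : Fin n, ‖u‖ * ‖w‖ := by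
        refine Finset.sum_le_sum fun i _ => ?_
        rw [abs_mul]
        exact mul_le_mul (norm_le_pi_norm u i) (norm_le_pi_norm w i) (abs_nonneg _)
          (norm_nonneg _)
    _ = n * (‖u‖ * ‖w‖) := by simp

lemma norm_mulVec_le_card_mul {M : Matrix (Fin n) (Fin n) ℝ} {C : ℝ} (hC : 0 ≤ C)
    (hM : ∀ i j, |M i j| ≤ C) (w : Fin n → ℝ) : ‖M *ᵥ w‖ ≤ n * C * ‖w‖ := by
  refine (pi_norm_le_iff_of_nonneg (by positivity)).2 fun i => ?_
  have h1 := abs_dotProduct_le_card_mul (M i) w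
  have h2 : ‖M i‖ ≤ C := (pi_norm_le_iff_of_nonneg hC).2 fun j => hM i j
  calc ‖(M *ᵥ w) i‖ ≤ n * (‖M i‖ * ‖w‖) := h1
    _ ≤ n * (C * ‖w‖) := by gcongr
    _ = n * C * ‖w‖ := by ring

lemma abs_dotProduct_mulVec_le {M : Matrix (Fin n) (Fin n) ℝ} {C : ℝ} (hC : 0 ≤ C)
    (hM : ∀ i j, |M i j| ≤ C) (w : Fin n → ℝ) : |w ⬝ᵥ (M *ᵥ w)| ≤ n * n * C * ‖w‖ ^ 2 := by
  calc |w ⬝ᵥ (M *ᵥ w)| ≤ n * (‖w‖ * ‖M *ᵥ w‖) := abs_dotProduct_le_card_mul _ _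
    _ ≤ n * (‖w‖ * (n * C * ‖w‖)) := by gcongr; exact norm_mulVec_le_card_mul hC hM w
    _ = n * n * C * ‖w‖ ^ 2 := by ring

/-- Every point of `ℝⁿ` is an integer translate of a point of the unit cube. -/
lemma exists_int_translate_mem_Icc (x : Fin n → ℝ) :
    ∃ k : Fin n → ℤ, (x + fun i => (k i : ℝ)) ∈ Set.Icc (0 : Fin n → ℝ) 1 := by
  refine ⟨fun i => -⌊x i⌋, fun i => ?_, fun i => ?_⟩
  · have := Int.floor_le (x i)
    simp only [Pi.zero_apply, Pi.add_apply, Int.cast_neg]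
    linarith
  · have := Int.lt_floor_add_one (x i)
    simp only [Pi.one_apply, Pi.add_apply, Int.cast_neg]
    linarith

lemma exists_bound_of_continuous_periodic {f : (Fin n → ℝ) → ℝ} (hf : Continuous f)
    (hper : ∀ (x : Fin n → ℝ) (k : Fin n → ℤ), f (x + fun i => (k i : ℝ)) = f x) :
    ∃ C, ∀ x, |f x| ≤ C := by
  obtain ⟨C, hC⟩ := (isCompact_Icc (a := (0 : Fin n → ℝ)) (b := 1)).exists_bound_of_continuousOn
    hf.continuousOn
  refine ⟨C, fun x => ?_⟩
  obtain ⟨k, hk⟩ := exists_int_translate_mem_Icc x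
  rw [← hper x k]
  exact hC _ hk

lemma exists_bound_of_continuous_periodic_matrix {ι : Type*} [Finite ι]
    {M : ι → (Fin n → ℝ) → Matrix (Fin n) (Fin n) ℝ}
    (hM : ∀ a i j, Continuous fun x => M a x i j)
    (hper : ∀ a (x : Fin n → ℝ) (k : Fin n → ℤ), M a (x + fun i => (k i : ℝ)) = M a x) :
    ∃ C, 0 ≤ C ∧ ∀ a x i j, |M a x i j| ≤ C := by
  have hex : ∀ t : ι × Fin n × Fin n, ∃ C, ∀ x, |M t.1 x t.2.1 t.2.2| ≤ C := fun t =>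
    exists_bound_of_continuous_periodic (hM t.1 t.2.1 t.2.2) fun x k => by rw [hper]
  choose C hC using hex
  obtain ⟨B, hB⟩ := (Set.finite_range C).bddAbove
  exact ⟨max B 0, le_max_right _ _, fun a x i j =>
    (hC (a, i, j) x).trans ((hB (Set.mem_range_self _)).trans (le_max_left _ _))⟩

lemma contDiff_det {N : ℕ} {M : (Fin n → ℝ) → Matrix (Fin N) (Fin N) ℝ}
    (hM : ∀ i j, ContDiff ℝ (⊤ : ℕ∞) fun x => M x i j) :
    ContDiff ℝ (⊤ : ℕ∞) fun x => (M x).det := by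
  simp only [Matrix.det_apply]
  exact ContDiff.sum fun σ _ => (contDiff_prod fun i _ => hM _ _).const_smul _

end MatrixBounds

namespace IsPeriodicMetric

variable {n : ℕ} {g : (Fin n → ℝ) → Matrix (Fin n) (Fin n) ℝ}

lemma contDiff_metricDeriv (hg : IsPeriodicMetric n g) (i b c : Fin n) :
    ContDiff ℝ (⊤ : ℕ∞) fun x => metricDeriv n g i x b c :=
  contDiff_partialDeriv' (hg.smooth b c) i

lemma metricDeriv_periodic (hg : IsPeriodicMetric n g) (i : Fin n) (x : Fin n → ℝ)
    (k : Fin n → ℤ) : metricDeriv n g i (x + fun i => (k i : ℝ)) = metricDeriv n g i x := by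
  ext b c
  simp only [metricDeriv, partialDeriv']
  congr 1
  funext h
  rw [add_right_comm, hg.periodic]

lemma det_ne_zero (hg : IsPeriodicMetric n g) (x : Fin n → ℝ) : (g x).det ≠ 0 :=
  (hg.posDef x).det_pos.ne'

lemma isUnit_det (hg : IsPeriodicMetric n g) (x : Fin n → ℝ) : IsUnit (g x).det :=
  isUnit_iff_ne_zero.2 (hg.det_ne_zero x)

lemma contDiff_inv (hg : IsPeriodicMetric n g) (i j : Fin n) :
    ContDiff ℝ (⊤ : ℕ∞) fun x => (g x)⁻¹ i j := by
  simp only [Matrix.inv_def, Ring.inverse_eq_inv', Matrix.smul_apply, smul_eq_mul,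
    Matrix.adjugate_apply]
  refine ((contDiff_det hg.smooth).inv hg.det_ne_zero).mul (contDiff_det fun a b => ?_)
  simp only [Matrix.updateRow_apply]
  split_ifs
  · exact contDiff_const
  · exact hg.smooth a b

lemma contDiff_geodesicVelocity (hg : IsPeriodicMetric n g) :
    ContDiff ℝ (⊤ : ℕ∞) (geodesicVelocity n g) := by
  refine contDiff_pi.2 fun i => ?_
  simp only [geodesicVelocity, Matrix.mulVec, dotProduct]
  refine ContDiff.sum fun j _ => ?_
  exact ((hg.contDiff_inv i j).comp contDiff_fst).mul ((contDiff_apply ℝ ℝ j).comp contDiff_snd)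

lemma contDiff_metricForce (hg : IsPeriodicMetric n g) :
    ContDiff ℝ (⊤ : ℕ∞) fun z : (Fin n → ℝ) × (Fin n → ℝ) => metricForce n g z.1 z.2 := by
  refine contDiff_pi.2 fun i => ?_
  simp only [metricForce, Matrix.mulVec, dotProduct]
  refine contDiff_const.mul (ContDiff.sum fun j _ => ?_)
  have hc : ∀ j : Fin n, ContDiff ℝ (⊤ : ℕ∞) fun z : (Fin n → ℝ) × (Fin n → ℝ) => z.2 j :=
    fun j => (contDiff_apply ℝ ℝ j).comp contDiff_snd
  exact (hc j).mul (ContDiff.sum fun k _ =>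
    ((hg.contDiff_metricDeriv i j k).comp contDiff_fst).mul (hc k))

lemma exists_coercive (hg : IsPeriodicMetric n g) :
    ∃ c, 0 < c ∧ ∀ x w, c * ‖w‖ ^ 2 ≤ w ⬝ᵥ (g x *ᵥ w) := by
  have hcont : Continuous fun z : (Fin n → ℝ) × (Fin n → ℝ) => z.2 ⬝ᵥ (g z.1 *ᵥ z.2) := by
    have hc : ∀ j : Fin n, Continuous fun z : (Fin n → ℝ) × (Fin n → ℝ) => z.2 j :=
      fun j => (continuous_apply j).comp continuous_snd
    simp only [Matrix.mulVec, dotProduct]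
    exact continuous_finsetSum _ fun i _ => (hc i).mul (continuous_finsetSum _ fun j _ =>
      ((hg.smooth i j).continuous.comp continuous_fst).mul (hc j))
  obtain ⟨c, hc, hmin⟩ := ((isCompact_Icc (a := (0 : Fin n → ℝ)) (b := 1)).prod
    (isCompact_sphere (0 : Fin n → ℝ) 1)).exists_forall_le' hcont.continuousOn (a := 0) (by
      rintro ⟨x, w⟩ ⟨_, hw⟩
      have hw0 : w ≠ 0 := by
        rintro rfl
        simp at hw
      simpa using (hg.posDef x).dotProduct_mulVec_pos hw0)
  refine ⟨c, hc, fun x w => ?_⟩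
  obtain ⟨k, hk⟩ := exists_int_translate_mem_Icc x
  rcases eq_or_ne w 0 with rfl | hw
  · simp
  have hw' : 0 < ‖w‖ := norm_pos_iff.2 hw
  have h1 := hmin (x + fun i => (k i : ℝ), ‖w‖⁻¹ • w) ⟨hk, by simp [norm_smul, hw'.ne']⟩
  simp only [hg.periodic, Matrix.mulVec_smul, smul_dotProduct, dotProduct_smul, smul_eq_mul] at h1
  calc c * ‖w‖ ^ 2 ≤ (‖w‖⁻¹ * (‖w‖⁻¹ * (w ⬝ᵥ (g x *ᵥ w)))) * ‖w‖ ^ 2 := by gcongr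
    _ = w ⬝ᵥ (g x *ᵥ w) := by field_simp

/-- Uniform bounds for the coefficients of a periodic metric and their derivatives. -/
lemma exists_bounds (hg : IsPeriodicMetric n g) :
    ∃ K, 0 ≤ K ∧ (∀ x w, ‖g x *ᵥ w‖ ≤ K * ‖w‖) ∧
      (∀ x w, w ⬝ᵥ (g x *ᵥ w) ≤ K * ‖w‖ ^ 2) ∧
      ∀ x w, ‖metricForce n g x w‖ ≤ K * ‖w‖ ^ 2 := by
  obtain ⟨C, hC, hgC⟩ := exists_bound_of_continuous_periodic_matrix (M := fun _ : Unit => g)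
    (fun _ i j => (hg.smooth i j).continuous) fun _ => hg.periodic
  obtain ⟨C', hC', hdC⟩ := exists_bound_of_continuous_periodic_matrix (M := metricDeriv n g)
    (fun i b c => (hg.contDiff_metricDeriv i b c).continuous) hg.metricDeriv_periodic
  have hK1 : (0 : ℝ) ≤ n * C := by positivity
  have hK2 : (0 : ℝ) ≤ n * n * C := by positivity
  have hK3 : (0 : ℝ) ≤ n * n * C' := by positivity
  refine ⟨n * C + n * n * C + n * n * C', by positivity, fun x w => ?_, fun x w => ?_,
    fun x w => ?_⟩
  · refine (norm_mulVec_le_card_mul hC (hgC () x) w).trans ?_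
    gcongr
    linarith
  · refine (le_abs_self _).trans ((abs_dotProduct_mulVec_le hC (hgC () x) w).trans ?_)
    gcongr
    linarith
  · refine (pi_norm_le_iff_of_nonneg (by positivity)).2 fun i => ?_
    have h := abs_dotProduct_mulVec_le hC' (hdC i x) w
    have h2 : (n * n * C') * ‖w‖ ^ 2 ≤ (n * C + n * n * C + n * n * C') * ‖w‖ ^ 2 := by
      gcongr
      linarith
    rw [metricForce, Real.norm_eq_abs, abs_mul, abs_of_pos (by norm_num : (0 : ℝ) < 1 / 2)]
    linarith [abs_nonneg (w ⬝ᵥ (metricDeriv n g i x *ᵥ w))]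

end IsPeriodicMetric

section DiscreteMinimizer

variable {n : ℕ}

/-- Sequences of points of `ℝⁿ` which advance by `a` every `N` steps. -/
def IsTwistedPeriodic (N : ℕ) (a : Fin n → ℝ) (x : ℤ → Fin n → ℝ) : Prop :=
  ∀ j, x (j + N) = x j + a

/-- The discrete energy of one period of a sequence of points. -/
noncomputable def discreteEnergy (g : (Fin n → ℝ) → Matrix (Fin n) (Fin n) ℝ) (N : ℕ)
    (x : ℤ → Fin n → ℝ) : ℝ :=
  ∑ k ∈ Finset.range N, (x (k + 1) - x k) ⬝ᵥ (g (x k) *ᵥ (x (k + 1) - x k))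

/-- Minimizers of the discrete energy among the sequences which advance by `a` every `N` steps. -/
def IsDiscreteMinimizer (g : (Fin n → ℝ) → Matrix (Fin n) (Fin n) ℝ) (N : ℕ)
    (a : Fin n → ℝ) (x : ℤ → Fin n → ℝ) : Prop :=
  IsTwistedPeriodic N a x ∧ ∀ y, IsTwistedPeriodic N a y →
    discreteEnergy g N x ≤ discreteEnergy g N y

lemma forall_int_of_periodic {X : Type*} {N : ℕ} (hN : 0 < N) {f : ℤ → X}
    (hf : ∀ j, f (j + N) = f j) {P : X → Prop} (h : ∀ k < N, P (f (k : ℕ))) (j : ℤ) : P (f j) := by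
  have hper : Function.Periodic f (N : ℤ) := hf
  have hmod : f (j % N) = f j := by
    conv_rhs => rw [← Int.emod_add_mul_ediv j N, mul_comm]
    simpa using (hper.int_mul (j / N) (j % N)).symm
  have h0 : 0 ≤ j % N := Int.emod_nonneg _ (by omega)
  have h1 : j % N < N := Int.emod_lt_of_pos _ (by omega)
  rw [← hmod, ← Int.toNat_of_nonneg h0]
  exact h _ (by omega)

lemma sum_range_shift_of_periodic {N : ℕ} {f : ℤ → ℝ} (hf : ∀ j, f (j + N) = f j) :
    ∑ k ∈ Finset.range N, f ((k : ℤ) + 1) = ∑ k ∈ Finset.range N, f k := by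
  have h1 := Finset.sum_range_succ (fun k : ℕ => f k) N
  have h2 := Finset.sum_range_succ' (fun k : ℕ => f k) N
  have h3 := hf 0
  simp only [zero_add] at h3
  push_cast at h1 h2
  linarith

namespace IsTwistedPeriodic

variable {N : ℕ} {a : Fin n → ℝ} {x : ℤ → Fin n → ℝ}
  {g : (Fin n → ℝ) → Matrix (Fin n) (Fin n) ℝ}

lemma shift (hx : IsTwistedPeriodic N a x) (c : ℤ) :
    IsTwistedPeriodic N a fun j => x (j + c) := fun j => by
  beta_reduce
  rw [add_right_comm]
  exact hx _

lemma add_const (hx : IsTwistedPeriodic N a x) (v : Fin n → ℝ) :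
    IsTwistedPeriodic N a fun j => x j + v := fun j => by
  beta_reduce
  rw [hx j, add_right_comm]

lemma step_periodic (hx : IsTwistedPeriodic N a x) (j : ℤ) :
    x (j + N + 1) - x (j + N) = x (j + 1) - x j := by
  rw [add_right_comm, hx, hx, add_sub_add_right_eq_sub]

lemma momentum_periodic {α : Fin n → ℤ} (hg : IsPeriodicMetric n g)
    (hx : IsTwistedPeriodic N (fun i => (α i : ℝ)) x) (j : ℤ) :
    g (x (j + N)) *ᵥ (x (j + N + 1) - x (j + N)) = g (x j) *ᵥ (x (j + 1) - x j) := by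
  rw [hx.step_periodic, hx, hg.periodic]

lemma discreteEnergy_shift {α : Fin n → ℤ} (hg : IsPeriodicMetric n g)
    (hx : IsTwistedPeriodic N (fun i => (α i : ℝ)) x) :
    discreteEnergy g N (fun j => x (j + 1)) = discreteEnergy g N x := by
  refine sum_range_shift_of_periodic
    (f := fun j => (x (j + 1) - x j) ⬝ᵥ (g (x j) *ᵥ (x (j + 1) - x j))) fun j => ?_
  rw [hx.momentum_periodic hg, hx.step_periodic]

end IsTwistedPeriodic

lemma isTwistedPeriodic_linear {N : ℕ} (hN : 0 < N) (a : Fin n → ℝ) :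
    IsTwistedPeriodic N a fun j => ((j : ℝ) / N) • a := fun j => by
  have : (N : ℝ) ≠ 0 := by positivity
  push_cast
  rw [add_div, div_self this, add_smul, one_smul]

lemma discreteEnergy_linear_le {g : (Fin n → ℝ) → Matrix (Fin n) (Fin n) ℝ} {K : ℝ}
    (hK : ∀ x w, w ⬝ᵥ (g x *ᵥ w) ≤ K * ‖w‖ ^ 2) {N : ℕ} (hN : 0 < N) (a : Fin n → ℝ) :
    discreteEnergy g N (fun j => ((j : ℝ) / N) • a) ≤ K * ‖a‖ ^ 2 / N := by
  have hN' : (0 : ℝ) < N := by positivity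
  calc discreteEnergy g N (fun j => ((j : ℝ) / N) • a)
      ≤ ∑ _k ∈ Finset.range N, K * ‖(N : ℝ)⁻¹ • a‖ ^ 2 := by
        refine Finset.sum_le_sum fun k _ => ?_
        have : (((k : ℤ) + 1 : ℤ) / N : ℝ) • a - (((k : ℤ) : ℝ) / N) • a = (N : ℝ)⁻¹ • a := by
          rw [← sub_smul]
          congr 1
          push_cast
          field_simp
          ring
        rw [this]
        exact hK _ _
    _ = K * ‖a‖ ^ 2 / N := by
        rw [Finset.sum_const, Finset.card_range, nsmul_eq_mul, norm_smul, norm_inv,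
          Real.norm_of_nonneg hN'.le]
        field_simp

lemma continuous_discreteEnergy {g : (Fin n → ℝ) → Matrix (Fin n) (Fin n) ℝ}
    (hg : IsPeriodicMetric n g) (N : ℕ) : Continuous (discreteEnergy g N) := by
  have hstep : ∀ (j : ℤ) (i : Fin n),
      Continuous fun x : ℤ → Fin n → ℝ => (x (j + 1) - x j) i := fun j i => by
    simp only [Pi.sub_apply]
    fun_prop
  unfold discreteEnergy
  simp only [Matrix.mulVec, dotProduct]
  refine continuous_finsetSum _ fun k _ => continuous_finsetSum _ fun i _ =>
    (hstep k i).mul (continuous_finsetSum _ fun j _ => ?_)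
  exact ((hg.smooth i j).continuous.comp (continuous_apply (k : ℤ))).mul (hstep k j)

lemma discreteEnergy_add_int {g : (Fin n → ℝ) → Matrix (Fin n) (Fin n) ℝ}
    (hg : IsPeriodicMetric n g) (N : ℕ) (x : ℤ → Fin n → ℝ) (k : Fin n → ℤ) :
    discreteEnergy g N (fun j => x j + fun i => (k i : ℝ)) = discreteEnergy g N x := by
  simp only [discreteEnergy, add_sub_add_right_eq_sub, hg.periodic]

lemma norm_step_le_of_discreteEnergy_le {g : (Fin n → ℝ) → Matrix (Fin n) (Fin n) ℝ}
    {c : ℝ} (hc : 0 < c) (hcoer : ∀ x w, c * ‖w‖ ^ 2 ≤ w ⬝ᵥ (g x *ᵥ w)) {N : ℕ} (hN : 0 < N)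
    {a : Fin n → ℝ} {x : ℤ → Fin n → ℝ} (hx : IsTwistedPeriodic N a x) {C : ℝ}
    (hC : discreteEnergy g N x ≤ C) (j : ℤ) : ‖x (j + 1) - x j‖ ≤ C / c + 1 := by
  refine forall_int_of_periodic hN (f := fun j => x (j + 1) - x j) hx.step_periodic
    (P := fun v => ‖v‖ ≤ C / c + 1) (fun k hk => ?_) j
  have h1 := Finset.single_le_sum (s := Finset.range N)
    (f := fun k : ℕ => (x (k + 1) - x k) ⬝ᵥ (g (x k) *ᵥ (x (k + 1) - x k)))
    (fun i _ => (by positivity : (0 : ℝ) ≤ c * ‖x (i + 1) - x i‖ ^ 2).trans (hcoer _ _))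
    (Finset.mem_range.2 hk)
  have h2 := (hcoer _ _).trans (h1.trans hC)
  rw [mul_comm, ← le_div_iff₀ hc] at h2
  nlinarith [sq_nonneg (‖x (k + 1) - x k‖ - 1)]

lemma exists_isDiscreteMinimizer {g : (Fin n → ℝ) → Matrix (Fin n) (Fin n) ℝ}
    (hg : IsPeriodicMetric n g) {N : ℕ} (hN : 0 < N) (a : Fin n → ℝ) :
    ∃ x, IsDiscreteMinimizer g N a x ∧ ‖x 0‖ ≤ 1 := by
  obtain ⟨c, hc, hcoer⟩ := hg.exists_coercive
  set C := discreteEnergy g N (fun j => ((j : ℝ) / N) • a)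
  let S : Set (ℤ → Fin n → ℝ) := {x | IsTwistedPeriodic N a x} ∩
    {x | x 0 ∈ Set.Icc (0 : Fin n → ℝ) 1} ∩ {x | discreteEnergy g N x ≤ C}
  have hnorm : ∀ v ∈ Set.Icc (0 : Fin n → ℝ) 1, ‖v‖ ≤ 1 := fun v hv => by
    refine (pi_norm_le_iff_of_nonneg zero_le_one).2 fun i => ?_
    rw [Real.norm_of_nonneg (hv.1 i)]
    exact hv.2 i
  have hclosed : IsClosed S := by
    refine IsClosed.inter (IsClosed.inter ?_ ?_) ?_
    · simp only [IsTwistedPeriodic, Set.ofPred_forall]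
      exact isClosed_iInter fun j => isClosed_eq (by fun_prop) (by fun_prop)
    · exact isClosed_Icc.preimage (continuous_apply 0)
    · exact isClosed_le (continuous_discreteEnergy hg N) continuous_const
  have hsub : S ⊆ Set.univ.pi fun j : ℤ =>
      Metric.closedBall (0 : Fin n → ℝ) ((C / c + 1) * |(j : ℝ)| + 1) := by
    rintro x ⟨⟨hx, hx0⟩, hxC⟩ j -
    have h1 := norm_sub_le_of_forall_step (w := x) (a := 0) (b := j)
      fun k _ _ => norm_step_le_of_discreteEnergy_le hc hcoer hN hx hxC k
    have h2 := hnorm _ hx0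
    have h3 := norm_add_le (x j - x 0) (x 0)
    rw [sub_add_cancel] at h3
    rw [mem_closedBall_zero_iff]
    simp only [Int.cast_zero, sub_zero] at h1
    linarith
  have hcompact : IsCompact S :=
    (isCompact_univ_pi fun j => isCompact_closedBall _ _).of_isClosed_subset hclosed hsub
  have hne : S.Nonempty := ⟨fun j => ((j : ℝ) / N) • a,
    ⟨isTwistedPeriodic_linear hN a, by simp⟩, le_refl C⟩
  obtain ⟨x, hxS, hmin⟩ := hcompact.exists_isMinOn hne (continuous_discreteEnergy hg N).continuousOn
  refine ⟨x, ⟨hxS.1.1, fun y hy => ?_⟩, hnorm _ hxS.1.2⟩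
  rcases le_total C (discreteEnergy g N y) with h | h
  · exact hxS.2.trans h
  · obtain ⟨k, hk⟩ := exists_int_translate_mem_Icc (y 0)
    rw [← discreteEnergy_add_int hg N y k] at h ⊢
    exact hmin ⟨⟨hy.add_const _, hk⟩, h⟩

namespace IsDiscreteMinimizer

variable {N : ℕ} {x : ℤ → Fin n → ℝ} {g : (Fin n → ℝ) → Matrix (Fin n) (Fin n) ℝ}
  {α : Fin n → ℤ}

lemma shift (hg : IsPeriodicMetric n g) (hx : IsDiscreteMinimizer g N (fun i => (α i : ℝ)) x)
    (c : ℤ) : IsDiscreteMinimizer g N (fun i => (α i : ℝ)) fun j => x (j + c) := by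
  have hE : discreteEnergy g N (fun j => x (j + c)) = discreteEnergy g N x := by
    induction c using Int.induction_on with
    | zero => simp
    | succ c ih =>
      rw [← ih, ← (hx.1.shift c).discreteEnergy_shift hg]
      congr 1
      ext j : 1
      congr 1
      ring
    | pred c ih =>
      rw [← ih, ← (hx.1.shift (-c - 1)).discreteEnergy_shift hg]
      congr 1
      ext j : 1
      congr 1
      ring
  exact ⟨hx.1.shift c, fun y hy => hE ▸ hx.2 y hy⟩

end IsDiscreteMinimizer

lemma dotProduct_mulVec_add_smul_single {M : Matrix (Fin n) (Fin n) ℝ} (hM : M.IsSymm)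
    (w : Fin n → ℝ) (i : Fin n) (h : ℝ) :
    (w + h • (Pi.single i 1 : Fin n → ℝ)) ⬝ᵥ (M *ᵥ (w + h • (Pi.single i 1 : Fin n → ℝ))) =
      w ⬝ᵥ (M *ᵥ w) + h * (2 * (M *ᵥ w) i + h * M i i) := by
  have h1 : w ⬝ᵥ M.col i = (M *ᵥ w) i := by
    rw [dotProduct_comm]
    simp only [Matrix.mulVec, dotProduct, Matrix.col_apply]
    exact Finset.sum_congr rfl fun j _ => by rw [hM.apply]
  simp only [Matrix.mulVec_add, Matrix.mulVec_smul, add_dotProduct, dotProduct_add,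
    smul_dotProduct, dotProduct_smul, Matrix.mulVec_single_one, single_one_dotProduct,
    smul_eq_mul, h1, Matrix.col_apply]
  ring

lemma hasDerivAt_quadratic_form {g : (Fin n → ℝ) → Matrix (Fin n) (Fin n) ℝ}
    (hg : IsPeriodicMetric n g) (x w : Fin n → ℝ) (i : Fin n) :
    HasDerivAt (fun h : ℝ => w ⬝ᵥ (g (x + h • (Pi.single i 1 : Fin n → ℝ)) *ᵥ w))
      (w ⬝ᵥ (metricDeriv n g i x *ᵥ w)) 0 := by
  simp only [Matrix.mulVec, dotProduct]
  refine HasDerivAt.fun_sum fun b _ => HasDerivAt.const_mul _ (HasDerivAt.fun_sum fun c _ =>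
    HasDerivAt.mul_const ?_ _)
  have hd : Differentiable ℝ fun y => g y b c := (hg.smooth b c).differentiable (by simp)
  rw [metricDeriv, partialDeriv'_eq_fderiv hd]
  exact hasDerivAt_comp_add_smul_single hd i x

/-- The discrete Euler–Lagrange equation. -/
lemma IsDiscreteMinimizer.momentum_sub {N : ℕ} (hN : 2 ≤ N) {x : ℤ → Fin n → ℝ}
    {g : (Fin n → ℝ) → Matrix (Fin n) (Fin n) ℝ} (hg : IsPeriodicMetric n g) {a : Fin n → ℝ}
    (hx : IsDiscreteMinimizer g N a x) :
    g (x 1) *ᵥ (x 2 - x 1) - g (x 0) *ᵥ (x 1 - x 0) = metricForce n g (x 1) (x 2 - x 1) := by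
  obtain ⟨M, rfl⟩ := Nat.exists_eq_add_of_le' hN
  ext i
  set e : Fin n → ℝ := Pi.single i 1 with he
  let y : ℝ → ℤ → Fin n → ℝ := fun h j =>
    x j + if ((M + 2 : ℕ) : ℤ) ∣ j - 1 then h • e else 0
  have hy : ∀ h, IsTwistedPeriodic (M + 2) a (y h) := fun h j => by
    have : ((M + 2 : ℕ) : ℤ) ∣ j + ((M + 2 : ℕ) : ℤ) - 1 ↔ ((M + 2 : ℕ) : ℤ) ∣ j - 1 := by
      rw [add_sub_right_comm]
      exact dvd_add_self_right
    simp only [y, this, hx.1 j]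
    exact add_right_comm _ _ _
  have hy0 : ∀ h, y h 0 = x 0 := fun h => by
    have : ¬ ((M + 2 : ℕ) : ℤ) ∣ 0 - 1 := by
      rw [zero_sub, dvd_neg]
      intro hd
      have := Int.le_of_dvd one_pos hd
      omega
    simp only [y, if_neg this, add_zero]
  have hy1 : ∀ h, y h 1 = x 1 + h • e := fun h => by simp [y]
  have hyk : ∀ h, ∀ k : ℕ, k ≤ M → y h ((k : ℤ) + 2) = x (k + 2) := fun h k hk => by
    have : ¬ ((M + 2 : ℕ) : ℤ) ∣ (k : ℤ) + 2 - 1 := fun hd => by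
      have := Int.le_of_dvd (by omega) hd
      omega
    simp only [y, if_neg this, add_zero]
  have hsplit : ∀ z : ℤ → Fin n → ℝ, discreteEnergy g (M + 2) z =
      (∑ k ∈ Finset.range M, (z (k + 2 + 1) - z (k + 2)) ⬝ᵥ
        (g (z (k + 2)) *ᵥ (z (k + 2 + 1) - z (k + 2)))) +
      (z 2 - z 1) ⬝ᵥ (g (z 1) *ᵥ (z 2 - z 1)) + (z 1 - z 0) ⬝ᵥ (g (z 0) *ᵥ (z 1 - z 0)) :=
    fun z => by
      rw [discreteEnergy, Finset.sum_range_succ', Finset.sum_range_succ']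
      push_cast
      norm_num [add_assoc]
  have hmin : ∀ h : ℝ,
      (x 2 - x 1) ⬝ᵥ (g (x 1) *ᵥ (x 2 - x 1)) + (x 1 - x 0) ⬝ᵥ (g (x 0) *ᵥ (x 1 - x 0)) ≤
      (x 2 - x 1 + (-h) • e) ⬝ᵥ (g (x 1 + h • e) *ᵥ (x 2 - x 1 + (-h) • e)) +
        (x 1 - x 0 + h • e) ⬝ᵥ (g (x 0) *ᵥ (x 1 - x 0 + h • e)) := fun h => by
    have h1 := hx.2 _ (hy h)
    rw [hsplit, hsplit] at h1
    have h2 : y h 2 = x 2 := by simpa using hyk h 0 (Nat.zero_le _)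
    have h3 : ∀ k ∈ Finset.range M, (y h (k + 2 + 1) - y h (k + 2)) ⬝ᵥ
        (g (y h (k + 2)) *ᵥ (y h (k + 2 + 1) - y h (k + 2))) = (x (k + 2 + 1) - x (k + 2)) ⬝ᵥ
        (g (x (k + 2)) *ᵥ (x (k + 2 + 1) - x (k + 2))) := fun k hk => by
      have hk' := Finset.mem_range.1 hk
      have h4 : y h ((k : ℤ) + 2 + 1) = x (k + 2 + 1) := by
        have := hyk h (k + 1) hk'
        push_cast at this
        rwa [add_right_comm (k : ℤ) 2 1]
      rw [h4, hyk h k hk'.le]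
    rw [Finset.sum_congr rfl h3, h2, hy0, hy1] at h1
    have h5 : x 2 - (x 1 + h • e) = x 2 - x 1 + (-h) • e := by
      rw [neg_smul]
      abel
    have h6 : x 1 + h • e - x 0 = x 1 - x 0 + h • e := by abel
    rw [h5, h6] at h1
    linarith
  simp only [he, dotProduct_mulVec_add_smul_single (hg.symm _)] at hmin
  have hline : ContDiff ℝ (⊤ : ℕ∞) fun h : ℝ => x 1 + h • (Pi.single i 1 : Fin n → ℝ) :=
    contDiff_const.add (contDiff_id.smul contDiff_const)
  have hd1 : Differentiable ℝ fun h : ℝ =>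
      (g (x 1 + h • (Pi.single i 1 : Fin n → ℝ)) *ᵥ (x 2 - x 1)) i := by
    simp only [Matrix.mulVec, dotProduct]
    exact (ContDiff.sum fun j _ => ((hg.smooth i j).comp hline).mul contDiff_const).differentiable
      (by simp)
  have hd2 : Differentiable ℝ fun h : ℝ => g (x 1 + h • (Pi.single i 1 : Fin n → ℝ)) i i :=
    ((hg.smooth i i).comp hline).differentiable (by simp)
  have hder := ((hasDerivAt_quadratic_form hg (x 1) (x 2 - x 1) i).add
    ((hasDerivAt_id (0 : ℝ)).neg.mul (((hd1 0).hasDerivAt.const_mul 2).add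
      ((hasDerivAt_id (0 : ℝ)).neg.mul (hd2 0).hasDerivAt)))).add
    (((hasDerivAt_id (0 : ℝ)).mul ((hasDerivAt_const (0 : ℝ) (2 * (g (x 0) *ᵥ (x 1 - x 0)) i)).add
      ((hasDerivAt_id (0 : ℝ)).mul_const (g (x 0) i i)))).const_add
      ((x 1 - x 0) ⬝ᵥ (g (x 0) *ᵥ (x 1 - x 0))))
  have hzero := IsLocalMin.hasDerivAt_eq_zero (Filter.Eventually.of_forall fun h => by
    simpa using hmin h) hder
  simp [-sub_dotProduct] at hzero
  simp only [metricForce, Pi.sub_apply]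
  linarith

end DiscreteMinimizer

section DiscreteBounds

variable {n : ℕ} {g : (Fin n → ℝ) → Matrix (Fin n) (Fin n) ℝ}

lemma metricForce_smul (x w : Fin n → ℝ) (c : ℝ) :
    metricForce n g x (c • w) = c ^ 2 • metricForce n g x w := by
  ext i
  simp only [metricForce, Matrix.mulVec_smul, smul_dotProduct, dotProduct_smul, Pi.smul_apply,
    smul_eq_mul]
  ring

lemma IsPeriodicMetric.geodesicVelocity_mulVec (hg : IsPeriodicMetric n g) (x w : Fin n → ℝ) :
    geodesicVelocity n g (x, g x *ᵥ w) = w := by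
  simp [geodesicVelocity, Matrix.mulVec_mulVec, Matrix.nonsing_inv_mul _ (hg.isUnit_det x)]

/-- Discrete energies control the total discrete force over a period, so discrete minimizers have
uniformly bounded momentum. -/
lemma IsDiscreteMinimizer.norm_momentum_le {K c : ℝ} (hK : 0 ≤ K) (hc : 0 < c)
    (hg : IsPeriodicMetric n g) (hgK : ∀ x w, ‖g x *ᵥ w‖ ≤ K * ‖w‖)
    (hqK : ∀ x w, w ⬝ᵥ (g x *ᵥ w) ≤ K * ‖w‖ ^ 2)
    (hfK : ∀ x w, ‖metricForce n g x w‖ ≤ K * ‖w‖ ^ 2)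
    (hcoer : ∀ x w, c * ‖w‖ ^ 2 ≤ w ⬝ᵥ (g x *ᵥ w)) {N : ℕ} (hN : 2 ≤ N) {α : Fin n → ℤ}
    {x : ℤ → Fin n → ℝ} (hx : IsDiscreteMinimizer g N (fun i => (α i : ℝ)) x) {p : ℤ → Fin n → ℝ}
    (hp : ∀ j, p j = g (x j) *ᵥ ((N : ℝ) • (x (j + 1) - x j)))
    (hstep : ∀ j, p (j + 1) - p j =
      (N : ℝ)⁻¹ • metricForce n g (x (j + 1)) ((N : ℝ) • (x (j + 1 + 1) - x (j + 1)))) (j : ℤ) :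
    ‖p j‖ ≤ K * (3 * (K * ‖fun i => (α i : ℝ)‖ ^ 2 / c) + 1) := by
  have hN0 : 0 < N := by omega
  have hNR : (0 : ℝ) < N := by exact_mod_cast hN0
  set B := K * ‖fun i => (α i : ℝ)‖ ^ 2 / c with hB
  set f : ℤ → ℝ := fun j => (N : ℝ) * ‖x (j + 1) - x j‖ ^ 2 with hf
  have hfper : ∀ j, f (j + N) = f j := fun j => by simp only [hf, hx.1.step_periodic]
  have hsum : ∑ k ∈ Finset.range N, f k ≤ B := by
    have h1 := (hx.2 _ (isTwistedPeriodic_linear hN0 _)).trans (discreteEnergy_linear_le hqK hN0 _)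
    have h2 : c * ∑ k ∈ Finset.range N, ‖x (k + 1) - x k‖ ^ 2 ≤ discreteEnergy g N x := by
      rw [Finset.mul_sum]
      exact Finset.sum_le_sum fun k _ => hcoer _ _
    have h3 := h2.trans h1
    rw [hB, le_div_iff₀ hc, ← Finset.mul_sum]
    rw [le_div_iff₀ hNR] at h3
    linarith
  have hforce : ∀ j, ‖p (j + 1) - p j‖ ≤ K * f (j + 1) := fun j => by
    rw [hstep, metricForce_smul, smul_smul, norm_smul, Real.norm_of_nonneg (by positivity)]
    calc (N : ℝ)⁻¹ * (N : ℝ) ^ 2 * ‖metricForce n g (x (j + 1)) (x (j + 1 + 1) - x (j + 1))‖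
        ≤ (N : ℝ)⁻¹ * (N : ℝ) ^ 2 * (K * ‖x (j + 1 + 1) - x (j + 1)‖ ^ 2) := by
          gcongr
          exact hfK _ _
      _ = K * f (j + 1) := by
          simp only [hf]
          field_simp
  have hosc : ∀ k < N, ‖p (k : ℕ) - p 0‖ ≤ K * B := fun k hk => by
    have h1 : ∀ m : ℕ, ‖p m - p 0‖ ≤ ∑ i ∈ Finset.range m, K * f ((i : ℤ) + 1) := fun m => by
      induction m with
      | zero => simp
      | succ m ih =>
        rw [Finset.sum_range_succ]
        have h2 := norm_add_le (p ((m : ℤ) + 1) - p m) (p m - p 0)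
        rw [sub_add_sub_cancel] at h2
        push_cast
        linarith [hforce m]
    calc ‖p (k : ℕ) - p 0‖ ≤ ∑ i ∈ Finset.range k, K * f ((i : ℤ) + 1) := h1 k
      _ ≤ ∑ i ∈ Finset.range N, K * f ((i : ℤ) + 1) :=
          Finset.sum_le_sum_of_subset_of_nonneg (Finset.range_mono hk.le)
            fun _ _ _ => by positivity
      _ = K * ∑ i ∈ Finset.range N, f i := by
          rw [← Finset.mul_sum, sum_range_shift_of_periodic hfper]
      _ ≤ K * B := by gcongr
  obtain ⟨k₀, hk₀, hk₀B⟩ : ∃ k ∈ Finset.range N, f (k : ℤ) ≤ B / N := by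
    refine Finset.exists_le_of_sum_le (Finset.nonempty_range_iff.2 hN0.ne') (hsum.trans_eq ?_)
    rw [Finset.sum_const, Finset.card_range, nsmul_eq_mul]
    field_simp
  have hp₀ : ‖p k₀‖ ≤ K * (B + 1) := by
    rw [hp]
    refine (hgK _ _).trans ?_
    gcongr
    have h1 : ‖(N : ℝ) • (x (k₀ + 1) - x k₀)‖ ^ 2 ≤ B := by
      rw [norm_smul, Real.norm_of_nonneg hNR.le, mul_pow]
      rw [le_div_iff₀ hNR] at hk₀B
      calc (N : ℝ) ^ 2 * ‖x (k₀ + 1) - x k₀‖ ^ 2 = f k₀ * N := by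
            simp only [hf]
            ring
        _ ≤ B := hk₀B
    nlinarith [sq_nonneg (‖(N : ℝ) • (x (k₀ + 1) - x k₀)‖ - 1)]
  refine forall_int_of_periodic hN0 (f := p) (P := fun v => ‖v‖ ≤ K * (3 * B + 1))
    (fun j => ?_) (fun k hk => ?_) j
  · rw [hp, hp, Matrix.mulVec_smul, Matrix.mulVec_smul, hx.1.momentum_periodic hg]
  · have h1 := hosc k hk
    have h2 := hosc k₀ (Finset.mem_range.1 hk₀)
    have h3 := norm_sub_norm_le (p 0) (p k₀)
    have h4 := norm_sub_norm_le (p k) (p 0)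
    rw [norm_sub_rev] at h3
    linarith

/-- For every mesh `1 / N` there is a closed solution of a discretization of the geodesic equation,
with bounds uniform in `N`. -/
lemma exists_discrete_geodesic (hg : IsPeriodicMetric n g) (α : Fin n → ℤ) :
    ∃ L : ℝ, ∀ N : ℕ, 2 ≤ N → ∃ x p : ℤ → Fin n → ℝ,
      IsTwistedPeriodic N (fun i => (α i : ℝ)) x ∧ ‖x 0‖ ≤ 1 ∧ (∀ j, ‖p j‖ ≤ L) ∧
      (∀ j, ‖x (j + 1) - x j‖ ≤ L / N) ∧ (∀ j, ‖p (j + 1) - p j‖ ≤ L / N) ∧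
      (∀ j, x (j + 1) - x j = (N : ℝ)⁻¹ • geodesicVelocity n g (x j, p j)) ∧
      (∀ j, p (j + 1) - p j = (N : ℝ)⁻¹ •
        metricForce n g (x (j + 1)) (geodesicVelocity n g (x (j + 1), p (j + 1)))) := by
  obtain ⟨c, hc, hcoer⟩ := hg.exists_coercive
  obtain ⟨K, hK, hgK, hqK, hfK⟩ := hg.exists_bounds
  set P := K * (3 * (K * ‖fun i => (α i : ℝ)‖ ^ 2 / c) + 1)
  have hP0 : 0 ≤ P := by positivity
  set V := n * P / c with hV
  have hV0 : 0 ≤ V := by positivity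
  refine ⟨P + V + K * V ^ 2, fun N hN => ?_⟩
  have hNR : (0 : ℝ) < N := by
    have : 0 < N := by omega
    exact_mod_cast this
  obtain ⟨x, hx, hx0⟩ := exists_isDiscreteMinimizer hg (by omega : 0 < N) fun i => (α i : ℝ)
  let v : ℤ → Fin n → ℝ := fun j => (N : ℝ) • (x (j + 1) - x j)
  let p : ℤ → Fin n → ℝ := fun j => g (x j) *ᵥ v j
  have hvel : ∀ j, geodesicVelocity n g (x j, p j) = v j := fun j =>
    hg.geodesicVelocity_mulVec _ _
  have hxstep : ∀ j, x (j + 1) - x j = (N : ℝ)⁻¹ • v j := fun j =>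
    (inv_smul_smul₀ hNR.ne' _).symm
  have hpstep : ∀ j, p (j + 1) - p j = (N : ℝ)⁻¹ • metricForce n g (x (j + 1)) (v (j + 1)) :=
    fun j => by
      have h := (hx.shift hg j).momentum_sub hN hg
      have h2 : (2 : ℤ) + j = j + 1 + 1 := by ring
      rw [zero_add, add_comm 1 j, h2] at h
      simp only [p, v]
      rw [metricForce_smul, ← h, smul_smul, Matrix.mulVec_smul, Matrix.mulVec_smul, ← smul_sub]
      congr 1
      field_simp
  have hpP : ∀ j, ‖p j‖ ≤ P := fun j =>
    hx.norm_momentum_le hK hc hg hgK hqK hfK hcoer hN (fun _ => rfl) hpstep j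
  have hvV : ∀ j, ‖v j‖ ≤ V := fun j => by
    have h1 := (hcoer (x j) (v j)).trans ((le_abs_self _).trans
      (abs_dotProduct_le_card_mul (v j) (p j)))
    rcases (norm_nonneg (v j)).eq_or_lt with h0 | h0
    · rw [← h0]
      exact hV0
    · rw [hV, le_div_iff₀ hc]
      refine le_of_mul_le_mul_right ?_ h0
      calc ‖v j‖ * c * ‖v j‖ = c * ‖v j‖ ^ 2 := by ring
        _ ≤ n * (‖v j‖ * ‖p j‖) := h1
        _ ≤ n * (‖v j‖ * P) := by
            gcongr
            exact hpP j
        _ = n * P * ‖v j‖ := by ring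
  have hKV : 0 ≤ K * V ^ 2 := by positivity
  refine ⟨x, p, hx.1, hx0, fun j => (hpP j).trans (by linarith), fun j => ?_, fun j => ?_,
    fun j => by rw [hvel, hxstep], fun j => by rw [hvel, hpstep]⟩
  · rw [hxstep, norm_smul, norm_inv, Real.norm_of_nonneg hNR.le, div_eq_inv_mul]
    gcongr
    linarith [hvV j]
  · rw [hpstep, norm_smul, norm_inv, Real.norm_of_nonneg hNR.le, div_eq_inv_mul]
    gcongr
    calc ‖metricForce n g (x (j + 1)) (v (j + 1))‖ ≤ K * ‖v (j + 1)‖ ^ 2 := hfK _ _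
      _ ≤ K * V ^ 2 := by
          gcongr
          exact hvV _
      _ ≤ P + V + K * V ^ 2 := by linarith

end DiscreteBounds

section ClosedGeodesics

open Filter Topology

variable {n : ℕ} {g : (Fin n → ℝ) → Matrix (Fin n) (Fin n) ℝ}

/-- Hamilton's equations for the geodesic flow have a solution which is closed in a prescribed
homotopy class. -/
lemma exists_closed_hamiltonian_orbit (hg : IsPeriodicMetric n g) (α : Fin n → ℤ) :
    ∃ γ p : ℝ → Fin n → ℝ, IsLiftedLoopOfClass n γ α ∧
      (∀ s, HasDerivAt γ (geodesicVelocity n g (γ s, p s)) s) ∧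
      ∀ s, HasDerivAt p (metricForce n g (γ s) (geodesicVelocity n g (γ s, p s))) s := by
  obtain ⟨L, hL⟩ := exists_discrete_geodesic hg α
  choose! x p hx hx0 hpL hxstep hpstep hxeq hpeq using hL
  set l : Ultrafilter ℕ := hyperfilter ℕ
  have hlt : (l : Filter ℕ) ≤ atTop := Nat.hyperfilter_le_atTop
  have htwo : ∀ᶠ N : ℕ in l, 2 ≤ N := hlt (eventually_ge_atTop 2)
  have hL0 : 0 ≤ L := (norm_nonneg _).trans (hpL 2 le_rfl 0)
  have hlim : ∀ {u : ℕ → Fin n → ℝ} {C : ℝ}, (∀ N, 2 ≤ N → ‖u N‖ ≤ C) →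
      ∃ v, Tendsto u l (𝓝 v) := fun {u C} hu => by
    obtain ⟨v, -, hv⟩ := (isCompact_closedBall (0 : Fin n → ℝ) C).ultrafilter_le_nhds' (l.map u)
      (by
        rw [Ultrafilter.mem_map]
        filter_upwards [htwo] with N hN
        simpa using hu N hN)
    exact ⟨v, hv⟩
  have hxlim : ∀ t : ℝ, ∃ v, Tendsto (fun N : ℕ => x N ⌊(N : ℝ) * t⌋) l (𝓝 v) := fun t => by
    refine hlim (C := L * (|t| + 1) + 1) fun N hN => ?_
    have hNR : (2 : ℝ) ≤ N := by exact_mod_cast hN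
    have h1 := norm_sub_le_of_forall_step (w := x N) (a := 0) (b := ⌊(N : ℝ) * t⌋)
      fun j _ _ => hxstep N hN j
    have h2 := abs_floor_sub_floor_le ((N : ℝ) * t) 0
    simp only [Int.floor_zero, Int.cast_zero, sub_zero, abs_mul, Nat.abs_cast] at h1 h2
    have h3 : L / N * |(⌊(N : ℝ) * t⌋ : ℝ)| ≤ L * (|t| + 1) := by
      calc L / N * |(⌊(N : ℝ) * t⌋ : ℝ)| ≤ L / N * (N * |t| + N) := by
            gcongr
            linarith
        _ = L * (|t| + 1) := by field_simp
    have h4 := norm_add_le (x N ⌊(N : ℝ) * t⌋ - x N 0) (x N 0)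
    rw [sub_add_cancel] at h4
    linarith [hx0 N hN]
  have hplim : ∀ t : ℝ, ∃ v, Tendsto (fun N : ℕ => p N ⌊(N : ℝ) * t⌋) l (𝓝 v) := fun t =>
    hlim fun N hN => hpL N hN _
  choose γ hγ using hxlim
  choose q hq using hplim
  have hz : ∀ t : ℝ, Tendsto (fun N : ℕ => (x N ⌊(N : ℝ) * t⌋, p N ⌊(N : ℝ) * t⌋)) l
      (𝓝 (γ t, q t)) := fun t => (hγ t).prodMk_nhds (hq t)
  have hzstep : ∀ᶠ N : ℕ in l, ∀ j,
      ‖(x N (j + 1), p N (j + 1)) - (x N j, p N j)‖ ≤ L / N := by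
    filter_upwards [htwo] with N hN j
    exact max_le (hxstep N hN j) (hpstep N hN j)
  refine ⟨γ, q, fun s => ?_, fun s => ?_, fun s => ?_⟩
  · refine tendsto_nhds_unique (hγ (s + 1)) (((hγ s).add_const _).congr' ?_)
    filter_upwards [htwo] with N hN
    rw [← hx N hN, mul_add, mul_one, Int.floor_add_natCast]
  · refine hasDerivAt_of_tendsto_discrete hlt hg.contDiff_geodesicVelocity.continuous (c := 0)
      (z := fun N j => (x N j, p N j)) (zlim := fun t => (γ t, q t)) hz hγ hzstep ?_ s
    filter_upwards [htwo] with N hN j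
    rw [add_zero]
    exact hxeq N hN j
  · have hcont : Continuous fun z : (Fin n → ℝ) × (Fin n → ℝ) =>
        metricForce n g z.1 (geodesicVelocity n g z) :=
      hg.contDiff_metricForce.continuous.comp
        (continuous_fst.prodMk hg.contDiff_geodesicVelocity.continuous)
    refine hasDerivAt_of_tendsto_discrete hlt hcont (c := 1)
      (z := fun N j => (x N j, p N j)) (zlim := fun t => (γ t, q t)) hz hq hzstep ?_ s
    filter_upwards [htwo] with N hN j
    exact hpeq N hN j

lemma isGeodesic_of_hasDerivAt (hg : IsPeriodicMetric n g) {γ p : ℝ → Fin n → ℝ}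
    (hsmooth : ContDiff ℝ (⊤ : ℕ∞) γ)
    (hγ : ∀ s, HasDerivAt γ (geodesicVelocity n g (γ s, p s)) s)
    (hp : ∀ s, HasDerivAt p (metricForce n g (γ s) (geodesicVelocity n g (γ s, p s))) s) :
    IsGeodesic n g γ := by
  intro a s
  set v : Fin n → ℝ → ℝ := fun b u => deriv (fun w => γ w b) u with hv
  have hvγ : ∀ u, (fun b => v b u) = geodesicVelocity n g (γ u, p u) := fun u =>
    funext fun b => (hasDerivAt_pi.1 (hγ u) b).deriv
  have hpv : ∀ u, p u = g (γ u) *ᵥ fun b => v b u := fun u => by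
    rw [hvγ, geodesicVelocity, Matrix.mulVec_mulVec, Matrix.mul_nonsing_inv _ (hg.isUnit_det _),
      Matrix.one_mulVec]
  have hvd : ∀ b, HasDerivAt (v b) (deriv (v b) s) s := fun b => by
    have h1 : ContDiff ℝ (⊤ : ℕ∞) fun w => γ w b := contDiff_pi.1 hsmooth b
    have h2 : ContDiff ℝ (⊤ : ℕ∞) (deriv fun w => γ w b) :=
      (contDiff_infty_iff_deriv.1 h1).2
    exact (h2.differentiable (by simp) s).hasDerivAt
  have hgd : ∀ b c, HasDerivAt (fun u => g (γ u) b c)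
      (∑ i, metricDeriv n g i (γ s) b c * v i s) s := fun b c => by
    have hd : Differentiable ℝ fun y => g y b c := (hg.smooth b c).differentiable (by simp)
    have h1 := (hd (γ s)).hasFDerivAt.comp_hasDerivAt s (hγ s)
    rw [fderiv_apply_eq_sum_partialDeriv' hd, ← hvγ] at h1
    exact h1
  have hmomentum : ∀ i, ∑ b, ((∑ c, metricDeriv n g c (γ s) i b * v c s) * v b s +
      g (γ s) i b * deriv (v b) s) =
      (1 / 2) * ∑ b, v b s * ∑ c, metricDeriv n g i (γ s) b c * v c s := fun i => by
    have hpi : (fun u => p u i) = fun u => ∑ b, g (γ u) i b * v b u := funext fun u => by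
      rw [hpv]
      rfl
    have h1 := hasDerivAt_pi.1 (hp s) i
    rw [hpi] at h1
    have h2 := (HasDerivAt.fun_sum (u := Finset.univ)
      fun b _ => (hgd i b).mul (hvd b)).unique h1
    rw [← hvγ] at h2
    exact h2
  have hacc : ∀ i, ∑ b, g (γ s) i b * deriv (v b) s =
      -((1 / 2) * ∑ b, ∑ c, (metricDeriv n g c (γ s) i b + metricDeriv n g b (γ s) i c -
        metricDeriv n g i (γ s) b c) * v b s * v c s) := fun i => by
    have h1 := hmomentum i
    have h2 : ∑ b, ∑ c, metricDeriv n g b (γ s) i c * v b s * v c s =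
        ∑ b, ∑ c, metricDeriv n g c (γ s) i b * v b s * v c s := by
      rw [Finset.sum_comm]
      exact Finset.sum_congr rfl fun b _ => Finset.sum_congr rfl fun c _ => by ring
    have h3 : ∑ b, (∑ c, metricDeriv n g c (γ s) i b * v c s) * v b s =
        ∑ b, ∑ c, metricDeriv n g c (γ s) i b * v b s * v c s := by
      simp only [Finset.sum_mul]
      exact Finset.sum_congr rfl fun b _ => Finset.sum_congr rfl fun c _ => by ring
    have h4 : ∑ b, v b s * ∑ c, metricDeriv n g i (γ s) b c * v c s =
        ∑ b, ∑ c, metricDeriv n g i (γ s) b c * v b s * v c s := by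
      simp only [Finset.mul_sum]
      exact Finset.sum_congr rfl fun b _ => Finset.sum_congr rfl fun c _ => by ring
    rw [Finset.sum_add_distrib, h3, h4] at h1
    simp only [add_mul, sub_mul, Finset.sum_add_distrib, Finset.sum_sub_distrib, h2]
    linarith
  have hsolve : deriv (v a) s = ∑ i, (g (γ s))⁻¹ a i * ∑ b, g (γ s) i b * deriv (v b) s := by
    have h1 : (g (γ s))⁻¹ *ᵥ (g (γ s) *ᵥ fun b => deriv (v b) s) = fun b => deriv (v b) s := by
      rw [Matrix.mulVec_mulVec, Matrix.nonsing_inv_mul _ (hg.isUnit_det _), Matrix.one_mulVec]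
    exact (congrFun h1 a).symm
  have hchristoffel : ∑ b, ∑ c, christoffel n g a b c (γ s) * v b s * v c s =
      ∑ i, (g (γ s))⁻¹ a i * ((1 / 2) * ∑ b, ∑ c, (metricDeriv n g c (γ s) i b +
        metricDeriv n g b (γ s) i c - metricDeriv n g i (γ s) b c) * v b s * v c s) := by
    simp only [christoffel, Finset.mul_sum, Finset.sum_mul]
    conv_lhs =>
      enter [2, b]
      rw [Finset.sum_comm]
    rw [Finset.sum_comm]
    refine Finset.sum_congr rfl fun i _ => Finset.sum_congr rfl fun b _ =>
      Finset.sum_congr rfl fun c _ => ?_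
    simp only [metricDeriv]
    ring
  change deriv (v a) s + ∑ b, ∑ c, christoffel n g a b c (γ s) * v b s * v c s = 0
  rw [hchristoffel, hsolve, ← Finset.sum_add_distrib]
  refine Finset.sum_eq_zero fun i _ => ?_
  rw [hacc]
  ring

/-- A periodic metric on `ℝⁿ` has a closed geodesic in every class of `ℤⁿ`. -/
lemma IsPeriodicMetric.exists_closed_geodesic (hg : IsPeriodicMetric n g) (α : Fin n → ℤ) :
    ∃ γ : ℝ → Fin n → ℝ, ContDiff ℝ (⊤ : ℕ∞) γ ∧ IsGeodesic n g γ ∧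
      IsLiftedLoopOfClass n γ α := by
  obtain ⟨γ, p, hloop, hγ, hp⟩ := exists_closed_hamiltonian_orbit hg α
  have hF : ContDiff ℝ (⊤ : ℕ∞) fun z : (Fin n → ℝ) × (Fin n → ℝ) =>
      (geodesicVelocity n g z, metricForce n g z.1 (geodesicVelocity n g z)) :=
    hg.contDiff_geodesicVelocity.prodMk
      (hg.contDiff_metricForce.comp (contDiff_fst.prodMk hg.contDiff_geodesicVelocity))
  have hz : ContDiff ℝ (⊤ : ℕ∞) fun s => (γ s, p s) :=
    contDiff_of_hasDerivAt_comp hF fun s => (hγ s).prodMk (hp s)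
  exact ⟨γ, hz.fst, isGeodesic_of_hasDerivAt hg hz.fst hγ hp, hloop⟩

end ClosedGeodesics

/-- For an `n`-DoF pendulum on `𝕋ⁿ = ℝⁿ/ℤⁿ` with smooth positive definite
inertia tensor `m`, smooth potential `U`, and energy `E > max U`, for every nonzero tuple
`(α₁, …, αₙ) ∈ ℤⁿ` there exists a (nonconstant) closed geodesic of the Jacobi metric
`ᴶg = 2(E - U) m` in the free homotopy class `(α₁, …, αₙ)`: a periodic trajectory of the
system at energy `E` performing `αᵢ` full rotations around joint `i`. -/
theorem periodic_orbit_every_winding_class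
    (n : ℕ)
    (m : (Fin n → ℝ) → Matrix (Fin n) (Fin n) ℝ)
    (hmsmooth : ∀ i j, ContDiff ℝ (⊤ : ℕ∞) (fun x => m x i j))
    (hmsymm : ∀ x, (m x).IsSymm)
    (hmpos : ∀ x, (m x).PosDef)
    (hmper : ∀ (x : Fin n → ℝ) (k : Fin n → ℤ), m (x + fun i => (k i : ℝ)) = m x)
    (U : (Fin n → ℝ) → ℝ)
    (hUsmooth : ContDiff ℝ (⊤ : ℕ∞) U)
    (hUper : ∀ (x : Fin n → ℝ) (k : Fin n → ℤ), U (x + fun i => (k i : ℝ)) = U x)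
    (E : ℝ) (hE : ∀ x, U x < E)
    (α : Fin n → ℤ) (hα : α ≠ 0) :
    ∃ γ : ℝ → (Fin n → ℝ), ContDiff ℝ (⊤ : ℕ∞) γ ∧
      IsGeodesic n (fun x => (2 * (E - U x)) • m x) γ ∧
      IsLiftedLoopOfClass n γ α ∧
      (∃ s₁ s₂, γ s₁ ≠ γ s₂) := by
  have hg : IsPeriodicMetric n (fun x => (2 * (E - U x)) • m x) :=
    { smooth := fun i j =>
        (contDiff_const.mul (contDiff_const.sub hUsmooth)).mul (hmsmooth i j)
      symm := fun x => (hmsymm x).smul _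
      posDef := fun x => (hmpos x).smul (by linarith [hE x])
      periodic := fun x k => by rw [hUper, hmper] }
  obtain ⟨γ, hsmooth, hgeo, hloop⟩ := hg.exists_closed_geodesic α
  refine ⟨γ, hsmooth, hgeo, hloop, 0 + 1, 0, fun h => hα ?_⟩
  rw [hloop 0, add_eq_left] at h
  ext i
  have hi : (α i : ℝ) = 0 := congrFun h i
  exact_mod_cast hi
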